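/- arXiv:1803.01239 — 2 statements merged into one kernel-verified Lean document; each statement's English description precedes it below -/
import Mathlib

section
/- Let G be a block graph on [n], T ∈ C(G) a cutset with P_T(G) ∈ Minh(G), and v a vertex of G belonging to exactly two endblocks of G. Then T ∪ {v} is a cutset of G and P_{T∪{v}}(G) ∈ Minh(G). -/
/-!
Common definitions: binomial edge ideals, cutsets, the prime ideals `P_T(G)`,
block graphs, clique degrees, endblocks, decomposability, and their relative
versions for induced subgraphs (an induced subgraph of `G` is recorded by its
vertex set `W`).
-/

noncomputable section
open MvPolynomial

/-- The edge binomial `f_{ij} = x_i y_j - x_j y_i` in `K[x_v, y_v : v ∈ V]`,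
encoded as `MvPolynomial (V ⊕ V) K` with `Sum.inl i ↦ x_i`, `Sum.inr i ↦ y_i`. -/
def ebin (K : Type*) [Field K] {V : Type*} (i j : V) : MvPolynomial (V ⊕ V) K :=
  X (Sum.inl i) * X (Sum.inr j) - X (Sum.inl j) * X (Sum.inr i)

/-- The binomial edge ideal `J_G`, generated by the `f_{ij}` over the edges of `G`. -/
def binomialEdgeIdeal (K : Type*) [Field K] {V : Type*} (G : SimpleGraph V) :
    Ideal (MvPolynomial (V ⊕ V) K) :=
  Ideal.span {p | ∃ i j, G.Adj i j ∧ p = ebin K i j}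

/-- The binomial edge ideal of the induced subgraph of `G` on `W`, regarded as an
ideal of the full polynomial ring on all of `V`. -/
def binomialEdgeIdealOn (K : Type*) [Field K] {V : Type*} (G : SimpleGraph V)
    (W : Set V) : Ideal (MvPolynomial (V ⊕ V) K) :=
  Ideal.span {p | ∃ i ∈ W, ∃ j ∈ W, G.Adj i j ∧ p = ebin K i j}

/-- `c(T)`: the number of connected components of the induced subgraph on `Tᶜ`. -/
def numComp {V : Type*} (G : SimpleGraph V) (T : Set V) : ℕ :=
  Nat.card (G.induce Tᶜ).ConnectedComponent

/-- `T` is a cutset of `G` if `c(T ∖ {i}) < c(T)` for every `i ∈ T`. -/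
def IsCutset {V : Type*} (G : SimpleGraph V) (T : Set V) : Prop :=
  ∀ i ∈ T, numComp G (T \ {i}) < numComp G T

/-- The prime ideal `P_T(G)`, generated by the variables `x_i, y_i` for `i ∈ T`
together with all binomials `f_{ij}` with `i ≠ j` in one connected component of
the induced subgraph on `Tᶜ`. -/
def cutIdeal (K : Type*) [Field K] {V : Type*} (G : SimpleGraph V) (T : Set V) :
    Ideal (MvPolynomial (V ⊕ V) K) :=
  Ideal.span ({p | ∃ i ∈ T, p = X (Sum.inl i) ∨ p = X (Sum.inr i)} ∪
    {p | ∃ i j, ∃ (hi : i ∈ Tᶜ) (hj : j ∈ Tᶜ), i ≠ j ∧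
      (G.induce Tᶜ).Reachable ⟨i, hi⟩ ⟨j, hj⟩ ∧ p = ebin K i j})

/-- A graph is a block graph iff all its blocks are complete; equivalently,
the vertices of every cycle form a clique. -/
def IsBlockGraph {V : Type*} (G : SimpleGraph V) : Prop :=
  ∀ (v : V) (c : G.Walk v v), c.IsCycle →
    ∀ x ∈ c.support, ∀ y ∈ c.support, x ≠ y → G.Adj x y

/-- The clique degree of `v`: the number of maximal cliques of `G` containing `v`. -/
def cliqueDeg {V : Type*} (G : SimpleGraph V) (v : V) : ℕ :=
  {s : Set V | Maximal G.IsClique s ∧ v ∈ s}.ncard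

/-- `v` is a cutpoint of `G`: removing it increases the number of connected components. -/
def IsCutpoint {V : Type*} (G : SimpleGraph V) (v : V) : Prop :=
  Nat.card G.ConnectedComponent < Nat.card (G.induce {v}ᶜ).ConnectedComponent

/-- An endblock of a block graph: a maximal clique with at least two vertices
containing exactly one cutpoint. -/
def IsEndblock {V : Type*} (G : SimpleGraph V) (B : Set V) : Prop :=
  Maximal G.IsClique B ∧ 2 ≤ B.ncard ∧ ∃! w, w ∈ B ∧ IsCutpoint G w

/-- `P_T(G) ∈ Minh(G)`: `T` is a cutset whose prime `P_T(G)` has minimum height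
among all `P_{T'}(G)` with `T'` a cutset; since `height P_T(G) = n - c(T) + |T|`,
this says `c(T') + |T| ≤ c(T) + |T'|` for all cutsets `T'`. -/
def InMinh {V : Type*} (G : SimpleGraph V) (T : Set V) : Prop :=
  IsCutset G T ∧ ∀ T', IsCutset G T' →
    numComp G T' + T.ncard ≤ numComp G T + T'.ncard

/-! Relative versions: the graph under consideration is the induced subgraph of
`G` on the vertex set `W`. -/

/-- Number of connected components of the induced subgraph on `W` after removing `T`. -/
def numCompOn {V : Type*} (G : SimpleGraph V) (W T : Set V) : ℕ :=
  Nat.card (G.induce (W \ T)).ConnectedComponent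

/-- `T` is a cutset of the induced subgraph of `G` on `W`. -/
def IsCutsetOn {V : Type*} (G : SimpleGraph V) (W T : Set V) : Prop :=
  T ⊆ W ∧ ∀ i ∈ T, numCompOn G W (T \ {i}) < numCompOn G W T

/-- `P_T ∈ Minh` for the induced subgraph of `G` on `W`. -/
def InMinhOn {V : Type*} (G : SimpleGraph V) (W T : Set V) : Prop :=
  IsCutsetOn G W T ∧ ∀ T', IsCutsetOn G W T' →
    numCompOn G W T' + T.ncard ≤ numCompOn G W T + T'.ncard

/-- `B` is a maximal clique of the induced subgraph of `G` on `W`. -/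
def IsMaxCliqueOn {V : Type*} (G : SimpleGraph V) (W B : Set V) : Prop :=
  Maximal (fun s => s ⊆ W ∧ G.IsClique s) B

/-- Clique degree of `v` in the induced subgraph of `G` on `W`. -/
def cliqueDegOn {V : Type*} (G : SimpleGraph V) (W : Set V) (v : V) : ℕ :=
  {B : Set V | IsMaxCliqueOn G W B ∧ v ∈ B}.ncard

/-- `w` is a cutpoint of the induced subgraph of `G` on `W`. -/
def IsCutpointOn {V : Type*} (G : SimpleGraph V) (W : Set V) (w : V) : Prop :=
  w ∈ W ∧ Nat.card (G.induce W).ConnectedComponent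
    < Nat.card (G.induce (W \ {w})).ConnectedComponent

/-- `B` is an endblock of the induced subgraph of `G` on `W`. -/
def IsEndblockOn {V : Type*} (G : SimpleGraph V) (W B : Set V) : Prop :=
  IsMaxCliqueOn G W B ∧ 2 ≤ B.ncard ∧ ∃! w, w ∈ B ∧ IsCutpointOn G W w

/-- The induced subgraph of `G` on `W` is decomposable: it is the union of two
subgraphs, each containing an edge, whose vertex sets `W₁, W₂` intersect in a
single vertex that is a free vertex of both. -/
def DecomposableOn {V : Type*} (G : SimpleGraph V) (W : Set V) : Prop :=
  ∃ W₁ W₂ : Set V, ∃ v : V, W₁ ∪ W₂ = W ∧ W₁ ∩ W₂ = {v} ∧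
    (∃ a ∈ W₁, ∃ b ∈ W₁, G.Adj a b) ∧ (∃ a ∈ W₂, ∃ b ∈ W₂, G.Adj a b) ∧
    (∀ a b, a ∈ W → b ∈ W → G.Adj a b → (a ∈ W₁ ∧ b ∈ W₁) ∨ (a ∈ W₂ ∧ b ∈ W₂)) ∧
    cliqueDegOn G W₁ v = 1 ∧ cliqueDegOn G W₂ v = 1

/-- `𝒟` is the decomposition of the induced subgraph of `G` on `W` into
indecomposable components: the members cover `W` and all its edges, each member
is indecomposable (an isolated vertex or a graph with an edge), and two distinct
members meet in at most one vertex, which is free in both. -/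
def IsDecompositionOn {V : Type*} (G : SimpleGraph V) (W : Set V)
    (𝒟 : Finset (Set V)) : Prop :=
  (∀ U ∈ 𝒟, U ⊆ W) ∧ ⋃₀ ↑𝒟 = W ∧
  (∀ a b, a ∈ W → b ∈ W → G.Adj a b → ∃ U ∈ 𝒟, a ∈ U ∧ b ∈ U) ∧
  (∀ U ∈ 𝒟, (∃ a ∈ U, ∃ b ∈ U, G.Adj a b) ∨ (∃ w, U = {w} ∧ ∀ u ∈ W, ¬ G.Adj w u)) ∧
  (∀ U₁ ∈ 𝒟, ∀ U₂ ∈ 𝒟, U₁ ≠ U₂ →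
    U₁ ∩ U₂ = ∅ ∨ ∃ w, U₁ ∩ U₂ = {w} ∧ cliqueDegOn G U₁ w = 1 ∧ cliqueDegOn G U₂ w = 1) ∧
  (∀ U ∈ 𝒟, ¬ DecomposableOn G U)

/-- `i(G)`: the number of inner vertices (vertices of clique degree `> 1`) of the
induced subgraph of `G` on `W`. -/
def innerCountOn {V : Type*} (G : SimpleGraph V) (W : Set V) : ℕ :=
  {v | v ∈ W ∧ 1 < cliqueDegOn G W v}.ncard

namespace SimpleGraph

variable {V W : Type*}

lemma Reachable.of_forall_adj {G : SimpleGraph V} {H : SimpleGraph W} (f : V → W)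
    (hf : ∀ a b, G.Adj a b → H.Reachable (f a) (f b)) {a b : V} (h : G.Reachable a b) :
    H.Reachable (f a) (f b) := by
  obtain ⟨w⟩ := h
  induction w with
  | nil => exact .refl _
  | cons hab _ ih => exact (hf _ _ hab).trans ih

lemma card_connectedComponent_lt_of_hom [Finite V] {G : SimpleGraph V} {H : SimpleGraph W}
    (f : G →g H) (hsurj : ∀ x, ∃ y, H.Reachable (f y) x) {p q : V}
    (hpq : ¬ G.Reachable p q) (hfpq : H.Reachable (f p) (f q)) :
    Nat.card H.ConnectedComponent < Nat.card G.ConnectedComponent := by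
  have hs : Function.Surjective (ConnectedComponent.map f) := by
    refine ConnectedComponent.ind fun x => ?_
    obtain ⟨y, hy⟩ := hsurj x
    exact ⟨G.connectedComponentMk y, ConnectedComponent.sound hy⟩
  have hfin : Finite G.ConnectedComponent := inferInstance
  refine lt_of_le_of_ne (Nat.card_le_card_of_surjective _ hs) fun hcard => hpq ?_
  have hinj := ((Nat.bijective_iff_surjective_and_card _).2 ⟨hs, hcard.symm⟩).1
  exact ConnectedComponent.exact (hinj (ConnectedComponent.sound hfpq :
    (G.connectedComponentMk p).map f = (G.connectedComponentMk q).map f))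

end SimpleGraph

section BlockGraph

variable {V : Type*} {G : SimpleGraph V}

lemma IsBlockGraph.adj_of_reachable (hG : IsBlockGraph G) {i p q : V} (hp : G.Adj i p)
    (hq : G.Adj i q) (hpq : p ≠ q)
    (h : (G.induce {i}ᶜ).Reachable ⟨p, hp.ne'⟩ ⟨q, hq.ne'⟩) : G.Adj p q := by
  obtain ⟨w, hw⟩ := h.exists_isPath
  let e := SimpleGraph.Embedding.induce (G := G) ({i}ᶜ : Set V)
  let P : G.Walk p q := w.map e.toHom
  have hP : P.IsPath := hw.map e.injective
  have hi : i ∉ P.support := by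
    change i ∉ (w.map e.toHom).support
    rw [SimpleGraph.Walk.support_map, List.mem_map]
    rintro ⟨x, -, hx⟩
    exact x.2 hx
  have hcyc : (SimpleGraph.Walk.cons hp (P.concat hq.symm)).IsCycle := by
    rw [SimpleGraph.Walk.cons_isCycle_iff]
    refine ⟨hP.concat hi hq.symm, fun hmem => ?_⟩
    rw [SimpleGraph.Walk.edges_concat, List.concat_eq_append, List.mem_append,
      List.mem_singleton, Sym2.eq_swap (a := q), Sym2.congr_right] at hmem
    rcases hmem with hmem | hmem
    · exact hi (P.fst_mem_support_of_mem_edges hmem)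
    · exact hpq hmem
  exact hG i _ hcyc p (by simp) q (by simp) hpq

lemma numComp_lt_numComp_insert [Finite V] {T : Set V} {v p q : V} (hv : v ∉ T)
    (hp : G.Adj v p) (hq : G.Adj v q) (hpT : p ∉ T) (hqT : q ∉ T)
    (hpq : ¬ (G.induce {v}ᶜ).Reachable ⟨p, hp.ne'⟩ ⟨q, hq.ne'⟩) :
    numComp G T < numComp G (insert v T) := by
  have hsub : (insert v T)ᶜ ⊆ Tᶜ := Set.compl_subset_compl.2 (Set.subset_insert v T)
  have hsub' : (insert v T)ᶜ ⊆ ({v}ᶜ : Set V) := Set.compl_subset_compl.2 (by simp)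
  have hp' : p ∈ (insert v T)ᶜ := by simp [hp.ne', hpT]
  have hq' : q ∈ (insert v T)ᶜ := by simp [hq.ne', hqT]
  have hvp : (G.induce Tᶜ).Adj ⟨v, hv⟩ ⟨p, hpT⟩ := hp
  have hvq : (G.induce Tᶜ).Adj ⟨v, hv⟩ ⟨q, hqT⟩ := hq
  refine SimpleGraph.card_connectedComponent_lt_of_hom (G.induceHomOfLE hsub).toHom
    (fun x => ?_) (p := ⟨p, hp'⟩) (q := ⟨q, hq'⟩)
    (fun h => hpq (h.map (G.induceHomOfLE hsub').toHom))
    (hvp.reachable.symm.trans hvq.reachable)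
  obtain ⟨x, hx⟩ := x
  by_cases hxv : x = v
  · subst hxv
    exact ⟨⟨p, hp'⟩, hvp.reachable.symm⟩
  · exact ⟨⟨x, by simpa [hxv] using hx⟩, .refl _⟩

lemma isCutpoint_of_not_reachable [Finite V] {v p q : V}
    (hp : G.Adj v p) (hq : G.Adj v q)
    (hpq : ¬ (G.induce {v}ᶜ).Reachable ⟨p, hp.ne'⟩ ⟨q, hq.ne'⟩) : IsCutpoint G v := by
  refine SimpleGraph.card_connectedComponent_lt_of_hom
    (SimpleGraph.Embedding.induce ({v}ᶜ : Set V)).toHom (fun x => ?_) hpq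
    (hp.reachable.symm.trans hq.reachable)
  by_cases hxv : x = v
  · subst hxv
    exact ⟨⟨p, hp.ne'⟩, hp.reachable.symm⟩
  · exact ⟨⟨x, hxv⟩, .refl _⟩

lemma IsCutset.isCutpoint_of_mem [Finite V] (hG : IsBlockGraph G) {T : Set V}
    (hT : IsCutset G T) {i : V} (hi : i ∈ T) : IsCutpoint G i := by
  classical
  by_contra hcut
  have hclique : ∀ p q, G.Adj i p → G.Adj i q → p ≠ q → G.Adj p q := fun p q hp hq hpq =>
    hG.adj_of_reachable hp hq hpq
      (by_contra fun h => hcut (isCutpoint_of_not_reachable hp hq h))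
  have hsub : Tᶜ ⊆ (T \ {i})ᶜ := Set.compl_subset_compl.2 Set.sdiff_subset
  refine (hT i hi).not_ge (Nat.card_le_card_of_injective
    (SimpleGraph.ConnectedComponent.map (G.induceHomOfLE hsub).toHom) ?_)
  refine SimpleGraph.ConnectedComponent.ind fun x => SimpleGraph.ConnectedComponent.ind fun y => ?_
  intro hxy
  have hreach : (G.induce (T \ {i})ᶜ).Reachable ⟨x, hsub x.2⟩ ⟨y, hsub y.2⟩ :=
    SimpleGraph.ConnectedComponent.exact hxy
  -- Retract `i` onto a neighbour outside `T`, if there is one.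
  obtain ⟨p, hp⟩ : ∃ p : (Tᶜ : Set V), ∀ a ∉ T, G.Adj i a → G.Adj i p := by
    by_cases h : ∃ a ∉ T, G.Adj i a
    · obtain ⟨a, ha, hia⟩ := h
      exact ⟨⟨a, ha⟩, fun _ _ _ => hia⟩
    · exact ⟨x, fun a ha hia => (h ⟨a, ha, hia⟩).elim⟩
  let f : ((T \ {i})ᶜ : Set V) → (Tᶜ : Set V) := fun a => if h : (a : V) ∈ T then p else ⟨a, h⟩
  have hmem : ∀ a : ((T \ {i})ᶜ : Set V), (a : V) ∈ T → (a : V) = i := fun a ha =>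
    by_contra fun h => a.2 ⟨ha, h⟩
  have hnear : ∀ a (ha : a ∉ T), G.Adj i a → (G.induce Tᶜ).Reachable p ⟨a, ha⟩ := by
    intro a ha hia
    by_cases hpa : (p : V) = a
    · rw [show p = ⟨a, ha⟩ from Subtype.ext hpa]
    · exact SimpleGraph.Adj.reachable (hclique p a (hp a ha hia) hia hpa)
  have hf := hreach.of_forall_adj (H := G.induce Tᶜ) f (fun a b hab => by
    have hab' : G.Adj a b := hab
    by_cases ha : (a : V) ∈ T <;> by_cases hb : (b : V) ∈ T
    · simp [f, ha, hb]
    · simpa [f, ha, hb] using hnear b hb (by rwa [hmem a ha] at hab')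
    · simpa [f, ha, hb] using (hnear a ha (by rw [hmem b hb] at hab'; exact hab'.symm)).symm
    · simp only [f, ha, hb, dif_neg, not_false_eq_true]
      exact SimpleGraph.Adj.reachable hab')
  have hx : (x : V) ∉ T := x.2
  have hy : (y : V) ∉ T := y.2
  simp only [f, hx, hy, dif_neg, not_false_eq_true] at hf
  exact SimpleGraph.ConnectedComponent.sound hf

lemma exists_isCutset_le [Finite V] (G : SimpleGraph V) (T : Set V) :
    ∃ T', IsCutset G T' ∧ numComp G T + T'.ncard ≤ numComp G T' + T.ncard := by
  induction hk : T.ncard generalizing T with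
  | zero =>
    rw [Set.ncard_eq_zero] at hk
    exact ⟨T, fun i hi => by simp [hk] at hi, by simp [hk]⟩
  | succ k ih =>
    by_cases hT : IsCutset G T
    · exact ⟨T, hT, by omega⟩
    · simp only [IsCutset, not_forall, not_lt] at hT
      obtain ⟨i, hi, hle⟩ := hT
      obtain ⟨T', hT', h⟩ := ih (T \ {i}) (by rw [Set.ncard_sdiff_singleton_of_mem hi]; omega)
      exact ⟨T', hT', by omega⟩

lemma InMinh.numComp_add_ncard_le [Finite V] {T : Set V} (hT : InMinh G T) (T' : Set V) :
    numComp G T' + T.ncard ≤ numComp G T + T'.ncard := by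
  obtain ⟨S, hS, h⟩ := exists_isCutset_le G T'
  have := hT.2 S hS
  omega

lemma InMinh.of_le [Finite V] {T U : Set V} (hT : InMinh G T)
    (hU : numComp G T + U.ncard ≤ numComp G U + T.ncard) : InMinh G U := by
  refine ⟨fun i hi => ?_, fun T' _ => ?_⟩
  · have h := hT.numComp_add_ncard_le (U \ {i})
    have := Set.ncard_sdiff_singleton_add_one hi
    omega
  · have := hT.numComp_add_ncard_le T'
    omega

lemma exists_not_adj_of_maximal_isClique {B C : Set V} (hB : Maximal G.IsClique B)
    (hC : Maximal G.IsClique C) (hne : B ≠ C) : ∃ a ∈ B, ∃ b ∈ C, a ≠ b ∧ ¬ G.Adj a b := by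
  by_contra! h
  have hU : G.IsClique (B ∪ C) := by
    rintro a (ha | ha) b (hb | hb) hab
    · exact hB.prop ha hb hab
    · exact h a ha b hb hab
    · exact (h b hb a ha hab.symm).symm
    · exact hC.prop ha hb hab
  exact hne ((hB.eq_of_subset hU Set.subset_union_left).trans
    (hC.eq_of_subset hU Set.subset_union_right).symm)

lemma IsEndblock.eq_of_isCutpoint {B : Set V} (hB : IsEndblock G B) {a b : V} (ha : a ∈ B)
    (hb : b ∈ B) (hac : IsCutpoint G a) (hbc : IsCutpoint G b) : a = b :=
  hB.2.2.unique ⟨ha, hac⟩ ⟨hb, hbc⟩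

end BlockGraph

/-- if `G` is a block graph, `P_T(G) ∈ Minh(G)` and `v` belongs to
exactly two endblocks of `G`, then `T ∪ {v}` is a cutset and
`P_{T ∪ {v}}(G) ∈ Minh(G)`. -/
theorem insert_mem_minh_of_two_endblocks (n : ℕ) (K : Type*) [Field K]
    (G : SimpleGraph (Fin n)) (hblock : IsBlockGraph G)
    (T : Set (Fin n)) (hT : IsCutset G T) (hmin : InMinh G T) (v : Fin n)
    (hv : {B : Set (Fin n) | IsEndblock G B ∧ v ∈ B}.ncard = 2) :
    IsCutset G (insert v T) ∧ InMinh G (insert v T) := by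
  suffices h : InMinh G (insert v T) from ⟨h.1, h⟩
  by_cases hvT : v ∈ T
  · rwa [Set.insert_eq_of_mem hvT]
  obtain ⟨B, C, hne, hBC⟩ := Set.ncard_eq_two.1 hv
  obtain ⟨hB, hvB⟩ : IsEndblock G B ∧ v ∈ B := hBC.ge (by simp)
  obtain ⟨hC, hvC⟩ : IsEndblock G C ∧ v ∈ C := hBC.ge (by simp)
  obtain ⟨a, ha, b, hb, hab, hadj⟩ := exists_not_adj_of_maximal_isClique hB.1 hC.1 hne
  have hva : v ≠ a := by
    rintro rfl
    exact hadj (hC.1.prop hvC hb hab)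
  have hvb : v ≠ b := by
    rintro rfl
    exact hadj (hB.1.prop ha hvB hab)
  have hpa : G.Adj v a := hB.1.prop hvB ha hva
  have hpb : G.Adj v b := hC.1.prop hvC hb hvb
  have hreach := fun h => hadj (hblock.adj_of_reachable hpa hpb hab h)
  have hcut := isCutpoint_of_not_reachable hpa hpb hreach
  have haT : a ∉ T := fun h =>
    hva (hB.eq_of_isCutpoint hvB ha hcut (hT.isCutpoint_of_mem hblock h))
  have hbT : b ∉ T := fun h =>
    hvb (hC.eq_of_isCutpoint hvC hb hcut (hT.isCutpoint_of_mem hblock h))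
  have hlt := numComp_lt_numComp_insert hvT hpa hpb haT hbT hreach
  refine hmin.of_le ?_
  rw [Set.ncard_insert_of_notMem hvT]
  omega
end
end

section
/- Let G be a block graph on [n] and T ∈ C(G) a cutset such that P_T(G) ∈ Minh(G). If {v_1,…,v_r} ⊆ T is the set of all vertices of T with clique degree equal to 2 in G, then T ∖ {v_1,…,v_r} is a cutset of G and P_{T∖{v_1,…,v_r}}(G) ∈ Minh(G). -/
/-!
Common definitions: binomial edge ideals, cutsets, the prime ideals `P_T(G)`,
block graphs, clique degrees, endblocks, decomposability, and their relative
versions for induced subgraphs (an induced subgraph of `G` is recorded by its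
vertex set `W`).
-/

noncomputable section
open MvPolynomial

section CutsetLemmas

open SimpleGraph

variable {V : Type*} {G : SimpleGraph V} {S T : Set V}

/-- In a block graph, two neighbours of `i` connected by a walk avoiding `i` are equal or
adjacent. -/
lemma IsBlockGraph.adj_of_reachable_induce (hG : IsBlockGraph G) {i a b : V} (hi : i ∉ S)
    (ha : a ∈ S) (hb : b ∈ S) (hia : G.Adj i a) (hib : G.Adj i b) (hab : a ≠ b)
    (h : (G.induce S).Reachable ⟨a, ha⟩ ⟨b, hb⟩) : G.Adj a b := by
  classical
  obtain ⟨p, hp⟩ := h.exists_isPath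
  let f : G.induce S ↪g G := Embedding.induce S
  let q : G.Walk a b := p.map f.toHom
  have hq : q.IsPath := hp.map (f := f.toHom) f.injective
  have hiq : i ∉ q.support := by
    intro hmem
    change i ∈ (p.map f.toHom).support at hmem
    rw [Walk.support_map, List.mem_map] at hmem
    obtain ⟨x, -, rfl⟩ := hmem
    exact hi x.2
  have hcyc : (Walk.cons hia (q.concat hib.symm)).IsCycle := by
    refine (Walk.cons_isCycle_iff _ _).mpr ⟨hq.concat hiq hib.symm, ?_⟩
    rw [Walk.edges_concat, List.concat_eq_append, List.mem_append]
    rintro (he | he)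
    · exact hiq (q.fst_mem_support_of_mem_edges he)
    · simp only [List.mem_singleton, Sym2.eq_iff] at he
      rcases he with ⟨h₁, -⟩ | ⟨-, h₂⟩
      · exact hib.ne h₁
      · exact hab h₂
  refine hG i _ hcyc a ?_ b ?_ hab <;> simp [Walk.support_concat]

/-- `x` is connected within `Tᶜ` to a neighbour of `v`. -/
def Touches (G : SimpleGraph V) (T : Set V) (v : V) (x : ↥Tᶜ) : Prop :=
  ∃ c : ↥Tᶜ, G.Adj v c ∧ (G.induce Tᶜ).Reachable x c

/-- The inclusion of `G - T` into `G - (T ∖ {v})`. -/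
def inclSdiff (G : SimpleGraph V) (T : Set V) (v : V) :
    G.induce Tᶜ →g G.induce (T \ {v})ᶜ :=
  (SimpleGraph.induceHomOfLE G (Set.compl_subset_compl.mpr Set.sdiff_subset)).toHom

lemma reachable_or_touches {v : V} {x y : ↥Tᶜ}
    (h : (G.induce (T \ {v})ᶜ).Reachable (inclSdiff G T v x) (inclSdiff G T v y)) :
    (G.induce Tᶜ).Reachable x y ∨ Touches G T v x ∧ Touches G T v y := by
  have key : ∀ w : ↥(T \ {v})ᶜ, (G.induce (T \ {v})ᶜ).Reachable (inclSdiff G T v x) w →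
      (w.1 ∈ T → Touches G T v x) ∧ ∀ hw : w.1 ∈ Tᶜ,
        (G.induce Tᶜ).Reachable x ⟨w.1, hw⟩ ∨
          Touches G T v x ∧ Touches G T v ⟨w.1, hw⟩ := by
    intro w hw
    rw [reachable_iff_reflTransGen] at hw
    have eq_v : ∀ z : ↥(T \ {v})ᶜ, z.1 ∈ T → z.1 = v := by
      intro z hz
      by_contra hne
      exact z.2 ⟨hz, hne⟩
    induction hw with
    | refl => exact ⟨fun hx => absurd hx x.2, fun _ => Or.inl (Reachable.refl _)⟩
    | @tail b c _ hbc ih =>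
      have hadj : G.Adj b.1 c.1 := hbc
      obtain ⟨ih₁, ih₂⟩ := ih
      by_cases hb : b.1 ∈ T
      · have hbv := eq_v b hb
        refine ⟨fun _ => ih₁ hb, fun hc => Or.inr ⟨ih₁ hb, ⟨c.1, hc⟩, ?_, Reachable.refl _⟩⟩
        rwa [hbv] at hadj
      · refine ⟨fun hc => ?_, fun hc => ?_⟩
        · have hcv := eq_v c hc
          rw [hcv] at hadj
          rcases ih₂ hb with h | h
          · exact ⟨⟨b.1, hb⟩, hadj.symm, h⟩
          · exact h.1
        · have hbc' : (G.induce Tᶜ).Adj ⟨b.1, hb⟩ ⟨c.1, hc⟩ := hadj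
          rcases ih₂ hb with h | ⟨h, d, hd, hbd⟩
          · exact Or.inl (h.trans hbc'.reachable)
          · exact Or.inr ⟨h, d, hd, hbc'.symm.reachable.trans hbd⟩
  exact (key _ h).2 y.2

lemma exists_neighbors_of_numComp_lt [Finite V] {v : V}
    (h : numComp G (T \ {v}) < numComp G T) :
    ∃ a b : ↥Tᶜ, G.Adj v a ∧ G.Adj v b ∧ ¬ (G.induce Tᶜ).Reachable a b := by
  by_contra! hcon
  refine h.not_ge (Nat.card_le_card_of_injective
    (ConnectedComponent.map (inclSdiff G T v)) ?_)
  intro X Y hXY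
  induction X using ConnectedComponent.ind with | _ x
  induction Y using ConnectedComponent.ind with | _ y
  rw [ConnectedComponent.map_mk, ConnectedComponent.map_mk, ConnectedComponent.eq] at hXY
  rw [ConnectedComponent.eq]
  rcases reachable_or_touches hXY with h | ⟨⟨c, hc, hxc⟩, d, hd, hyd⟩
  · exact h
  · exact hxc.trans ((hcon c d hc hd).trans hyd.symm)

lemma numComp_lt_of_neighbors [Finite V] {v : V} {a b : ↥Tᶜ}
    (ha : G.Adj v a) (hb : G.Adj v b) (hab : ¬ (G.induce Tᶜ).Reachable a b) :
    numComp G (T \ {v}) < numComp G T := by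
  let φ := ConnectedComponent.map (inclSdiff G T v)
  have hv' : v ∈ (T \ {v})ᶜ := fun h => h.2 rfl
  have hva : (G.induce (T \ {v})ᶜ).Adj ⟨v, hv'⟩ (inclSdiff G T v a) := ha
  have hvb : (G.induce (T \ {v})ᶜ).Adj ⟨v, hv'⟩ (inclSdiff G T v b) := hb
  have hsurj : Function.Surjective φ := by
    intro X
    induction X using ConnectedComponent.ind with | _ x
    by_cases hx : x.1 ∈ T
    · have hxv : x = ⟨v, hv'⟩ := Subtype.ext (by
        by_contra hne
        exact x.2 ⟨hx, hne⟩)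
      refine ⟨(G.induce Tᶜ).connectedComponentMk a, ?_⟩
      rw [hxv]
      exact ConnectedComponent.eq.mpr hva.symm.reachable
    · exact ⟨(G.induce Tᶜ).connectedComponentMk ⟨x.1, hx⟩, rfl⟩
  refine lt_of_le_of_ne (Nat.card_le_card_of_surjective φ hsurj) fun heq => hab ?_
  have hinj := ((Nat.bijective_iff_surjective_and_card φ).mpr ⟨hsurj, heq.symm⟩).1
  refine ConnectedComponent.eq.mp (hinj ?_)
  exact ConnectedComponent.eq.mpr (hva.symm.reachable.trans hvb.reachable)

/-- In a block graph every subset of a cutset is a cutset. -/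
lemma IsCutset.subset [Finite V] (hG : IsBlockGraph G) (hT : IsCutset G T) (hST : S ⊆ T) :
    IsCutset G S := by
  intro i hi
  obtain ⟨a, b, ha, hb, hab⟩ := exists_neighbors_of_numComp_lt (hT i (hST hi))
  have haS : a.1 ∈ Sᶜ := fun h => a.2 (hST h)
  have hbS : b.1 ∈ Sᶜ := fun h => b.2 (hST h)
  refine numComp_lt_of_neighbors (a := ⟨a, haS⟩) (b := ⟨b, hbS⟩) ha hb fun h => hab ?_
  by_cases heq : a = b
  · exact heq ▸ Reachable.refl _
  · have hadj : G.Adj a.1 b.1 := hG.adj_of_reachable_induce (Set.notMem_compl_iff.mpr hi) haS hbS ha hb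
      (fun h => heq (Subtype.ext h)) h
    exact Adj.reachable (G := G.induce Tᶜ) hadj

lemma exists_maximal_isClique_of_adj [Finite V] {v a : V} (h : G.Adj v a) :
    ∃ C, Maximal G.IsClique C ∧ v ∈ C ∧ a ∈ C := by
  have hc : G.IsClique {v, a} := by
    rw [isClique_pair]
    exact fun _ => h
  obtain ⟨C, hle, hC⟩ := (Set.toFinite {s | G.IsClique s}).exists_le_maximal hc
  exact ⟨C, hC, hle (by simp), hle (by simp)⟩

/-- Deleting from a cutset a vertex of clique degree `2` loses at most one component. -/
lemma IsCutset.numComp_le_add_one [Finite V] (hT : IsCutset G T) {v : V} (hv : v ∈ T)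
    (hdeg : cliqueDeg G v = 2) : numComp G T ≤ numComp G (T \ {v}) + 1 := by
  obtain ⟨a, b, ha, hb, hab⟩ := exists_neighbors_of_numComp_lt (hT v hv)
  obtain ⟨A, hA, hvA, haA⟩ := exists_maximal_isClique_of_adj ha
  obtain ⟨B, hB, hvB, hbB⟩ := exists_maximal_isClique_of_adj hb
  have reach : ∀ {C : Set V} {x y : ↥Tᶜ}, Maximal G.IsClique C → x.1 ∈ C → y.1 ∈ C →
      (G.induce Tᶜ).Reachable x y := by
    intro C x y hC hx hy
    by_cases hxy : x = y
    · exact hxy ▸ Reachable.refl _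
    · have hadj : G.Adj x.1 y.1 := hC.prop hx hy (fun h => hxy (Subtype.ext h))
      exact Adj.reachable (G := G.induce Tᶜ) hadj
  have hAB : A ≠ B := by
    rintro rfl
    exact hab (reach hA haA hbB)
  have hcliques : {s : Set V | Maximal G.IsClique s ∧ v ∈ s} = {A, B} := by
    refine (Set.eq_of_subset_of_ncard_le ?_ ?_).symm
    · rintro s (rfl | rfl)
      exacts [⟨hA, hvA⟩, ⟨hB, hvB⟩]
    · rw [Set.ncard_pair hAB]
      exact hdeg.le
  have touch : ∀ x, Touches G T v x →
      (G.induce Tᶜ).Reachable x a ∨ (G.induce Tᶜ).Reachable x b := by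
    rintro x ⟨c, hc, hxc⟩
    obtain ⟨C, hC, hvC, hcC⟩ := exists_maximal_isClique_of_adj hc
    have hmem : C ∈ ({A, B} : Set (Set V)) := hcliques ▸ ⟨hC, hvC⟩
    rcases hmem with rfl | rfl
    · exact Or.inl (hxc.trans (reach hC hcC haA))
    · exact Or.inr (hxc.trans (reach hC hcC hbB))
  let φ := ConnectedComponent.map (inclSdiff G T v)
  let α := (G.induce Tᶜ).connectedComponentMk a
  have hinj : Set.InjOn φ {α}ᶜ := by
    intro X hX Y hY hXY
    induction X using ConnectedComponent.ind with | _ x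
    induction Y using ConnectedComponent.ind with | _ y
    have hXY' := ConnectedComponent.eq.mp hXY
    refine ConnectedComponent.eq.mpr ?_
    rcases reachable_or_touches hXY' with h | ⟨hx, hy⟩
    · exact h
    · have hxb := (touch x hx).resolve_left fun h => hX (ConnectedComponent.eq.mpr h)
      have hyb := (touch y hy).resolve_left fun h => hY (ConnectedComponent.eq.mpr h)
      exact hxb.trans hyb.symm
  have hle : ({α}ᶜ : Set _).ncard ≤ numComp G (T \ {v}) := by
    rw [numComp, ← Set.ncard_univ]
    exact Set.ncard_le_ncard_of_injOn φ (fun _ _ => Set.mem_univ _) hinj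
  have hcard := Set.ncard_add_ncard_compl {α}
  rw [Set.ncard_singleton] at hcard
  change Nat.card _ ≤ _
  lia

lemma IsCutset.numComp_add_ncard_sdiff_le [Finite V] (hG : IsBlockGraph G)
    (hT : IsCutset G T) {R : Set V} (hRT : R ⊆ T) (hR : ∀ v ∈ R, cliqueDeg G v = 2) :
    numComp G T + (T \ R).ncard ≤ numComp G (T \ R) + T.ncard := by
  induction R, R.toFinite using Set.Finite.induction_on with
  | empty => simp
  | @insert v R hvR _ ih =>
    have hv : v ∈ T \ R := ⟨hRT (Set.mem_insert v R), hvR⟩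
    have h₁ := ih ((Set.subset_insert v R).trans hRT)
      fun w hw => hR w (Set.mem_insert_of_mem v hw)
    have h₂ := (hT.subset hG Set.sdiff_subset).numComp_le_add_one hv (hR v (Set.mem_insert v R))
    have h₃ := Set.ncard_sdiff_singleton_add_one hv
    rw [Set.sdiff_sdiff, Set.union_singleton] at h₂ h₃
    lia

end CutsetLemmas

/-- if `G` is a block graph and `P_T(G) ∈ Minh(G)`, then removing
from `T` all vertices of clique degree `2` again yields a cutset whose prime is
in `Minh(G)`. -/
theorem sdiff_cliqueDeg_two_mem_minh (n : ℕ) (K : Type*) [Field K]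
    (G : SimpleGraph (Fin n)) (hblock : IsBlockGraph G)
    (T : Set (Fin n)) (hT : IsCutset G T) (hmin : InMinh G T) :
    IsCutset G (T \ {u | cliqueDeg G u = 2}) ∧ InMinh G (T \ {u | cliqueDeg G u = 2}) := by
  have hcut : IsCutset G (T \ {u | cliqueDeg G u = 2}) := hT.subset hblock Set.sdiff_subset
  refine ⟨hcut, hcut, fun T' hT' => ?_⟩
  have h := hT.numComp_add_ncard_sdiff_le hblock (R := T ∩ {u | cliqueDeg G u = 2})
    Set.inter_subset_left fun v hv => hv.2
  rw [Set.sdiff_self_inter] at h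
  have := hmin.2 T' hT'
  lia
end
end
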